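/- arXiv:math/0106232 — 2 statements merged into one kernel-verified Lean document; each statement's English description precedes it below -/
import Mathlib

section
/- Let q > 2 be a prime power and let N be the number of permutations σ of 𝔽_q such that the permutation polynomial f_σ has degree strictly smaller than q−2. Then |N − (q−1)!| ≤ √(2e/π) · q^{q/2}. -/
open Finset Polynomial

/-- The permutation polynomial of a permutation `σ` of a finite field:
`f_σ(x) = ∑_{c} σ(c) (1 - (x - c)^(q-1))`. -/
noncomputable def permPoly {F : Type*} [Field F] [Fintype F] (σ : Equiv.Perm F) : Polynomial F :=
  ∑ c : F, Polynomial.C (σ c) * (1 - (Polynomial.X - Polynomial.C c) ^ (Fintype.card F - 1))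

lemma cb_sq (n : ℕ) (hn : 0 < n) : ((n.centralBinom : ℝ))^2 * (Real.pi * n) ≤ 16^n := by
  have h1 := Real.Wallis.le_W n
  rw [Real.Wallis.W_eq_factorial_ratio] at h1
  have hc : (n.centralBinom : ℝ) * (n.factorial : ℝ)^2 = (2*n).factorial := by
    have := Nat.choose_mul_factorial_mul_factorial (show n ≤ 2*n by omega)
    rw [show 2*n-n = n by omega] at this
    rw [Nat.centralBinom]
    rw [← this]; push_cast; ring
  have hf : (0:ℝ) < n.factorial := by positivity
  have hb : (0:ℝ) < n.centralBinom := by exact_mod_cast n.centralBinom_pos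
  have hn' : (0:ℝ) < n := by exact_mod_cast hn
  rw [← hc] at h1
  have h16 : (2:ℝ)^(4*n) = 16^n := by rw [pow_mul]; norm_num
  rw [h16] at h1
  have e : (16:ℝ) ^ n * (n.factorial:ℝ) ^ 4 / (((n.centralBinom:ℝ) * (n.factorial:ℝ) ^ 2) ^ 2 * (2 * n + 1)) = 16^n / ((n.centralBinom:ℝ)^2 * (2*n+1)) := by
    field_simp
  rw [e, le_div_iff₀ (by positivity)] at h1
  refine le_trans ?_ h1
  have : (2 * (n:ℝ) + 1) / (2 * n + 2) * (Real.pi / 2) * ((n.centralBinom:ℝ) ^ 2 * (2 * n + 1)) = (n.centralBinom:ℝ) ^ 2 * Real.pi * ((2*n+1)^2/(4*(n+1))) := by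
    field_simp; ring
  rw [this, ← mul_assoc]
  gcongr
  rw [le_div_iff₀ (by positivity)]
  nlinarith

def DD (n : ℕ) : ℝ := ∑ S ∈ (range n).powerset, |2 * (#S : ℝ) - n|

lemma DD_succ (n : ℕ) : DD (n+1) = 2 * DD n + 2 * ∑ S ∈ (range n).powerset, (if 2 * #S = n then 1 else 0) := by
  unfold DD
  rw [range_add_one, sum_powerset_insert (by simp), ← sum_add_distrib, mul_sum, mul_sum, ← sum_add_distrib]
  refine sum_congr rfl fun S hS => ?_
  rw [card_insert_of_notMem (fun h => by simpa using (mem_powerset.1 hS) h)]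
  split_ifs with h
  · have : (n:ℝ) = 2 * #S := by exact_mod_cast h.symm
    push_cast; rw [this]
    rw [show 2 * (#S:ℝ) - (2 * #S + 1) = -1 by ring, show 2 * ((#S:ℝ)+1) - (2 * #S + 1) = 1 by ring]
    norm_num
  · push_cast
    rcases lt_or_gt_of_ne h with h | h
    · have : 2 * (#S:ℝ) + 1 ≤ n := by exact_mod_cast h
      rw [abs_of_nonpos (by linarith), abs_of_nonpos (by linarith), abs_of_nonpos (by linarith)]; ring
    · have : (n:ℝ) + 1 ≤ 2 * (#S:ℝ) := by exact_mod_cast h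
      rw [abs_of_nonneg (by linarith), abs_of_nonneg (by linarith), abs_of_nonneg (by linarith)]; ring

lemma DD_odd (m : ℕ) : DD (2*m+1) = 2 * DD (2*m) + 2 * m.centralBinom := by
  rw [DD_succ]
  congr 2
  rw [sum_boole, Nat.centralBinom]
  congr 1
  have := card_powersetCard m (range (2*m))
  rw [card_range] at this
  rw [← this]
  congr 1
  ext S; simp [mem_powersetCard]

lemma DD_even' (m : ℕ) : DD (2*m+2) = 2 * DD (2*m+1) := by
  rw [DD_succ, sum_eq_zero (fun S hS => if_neg (by omega))]; ring

lemma DD_even (m : ℕ) : DD (2*m) = 2 * m * m.centralBinom := by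
  induction m with
  | zero => simp [DD]
  | succ m ih =>
    rw [show 2 * (m+1) = 2*m+2 by ring, DD_even', DD_odd, ih]
    have := Nat.succ_mul_centralBinom_succ m
    have h : ((m:ℝ)+1) * (m+1).centralBinom = 2 * (2*m+1) * m.centralBinom := by exact_mod_cast this
    push_cast
    linear_combination -2 * h

lemma DD_nonneg (n : ℕ) : 0 ≤ DD n := sum_nonneg fun _ _ => abs_nonneg _

lemma DD_sq (q : ℕ) (hq : 2 < q) : DD q ^ 2 * (Real.pi * (q-1)) ≤ 2 * q^2 * 4^q := by
  rcases Nat.even_or_odd' q with ⟨m, rfl | rfl⟩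
  · have h := cb_sq m (by omega)
    have h16 : (4:ℝ)^(2*m) = 16^m := by rw [pow_mul]; norm_num
    have hm : (0:ℝ) < m := by exact_mod_cast (by omega : 0 < m)
    rw [DD_even, h16]
    have : DD (2*m)^2 * (Real.pi) = 4 * m * ((m.centralBinom : ℝ)^2 * (Real.pi * m)) := by rw [DD_even]; ring
    push_cast
    calc _ ≤ (2 * (m:ℝ) * m.centralBinom)^2 * (Real.pi * (2 * m)) := by
            gcongr; linarith
      _ = 8 * m^2 * ((m.centralBinom : ℝ)^2 * (Real.pi * m)) := by ring
      _ ≤ 8 * m^2 * 16^m := by gcongr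
      _ = _ := by ring
  · have h := cb_sq m (by omega)
    have h16 : (4:ℝ)^(2*m) = 16^m := by rw [pow_mul]; norm_num
    rw [DD_odd, DD_even, pow_succ (4:ℝ), h16]
    push_cast
    calc _ = 8 * (2*m+1)^2 * ((m.centralBinom : ℝ)^2 * (Real.pi * m)) := by ring
      _ ≤ 8 * (2*m+1)^2 * 16^m := by gcongr
      _ = _ := by ring

lemma ryser {F : Type*} [Fintype F] [DecidableEq F] (g : F → F → ℂ) :
    ∑ σ : Equiv.Perm F, ∏ c, g c (σ c) =
      ∑ S : Finset F, (-1)^(#Sᶜ) * ∏ c, ∑ t ∈ S, g c t := by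
  have h1 : ∀ S : Finset F, ∏ c, ∑ t ∈ S, g c t = ∑ f : F → F, if univ.image f ⊆ S then ∏ c, g c (f c) else 0 := by
    intro S
    rw [prod_univ_sum, ← sum_filter]
    refine sum_congr ?_ fun _ _ => rfl
    ext f; simp [Fintype.mem_piFinset, image_subset_iff]
  simp_rw [h1, mul_sum]
  rw [sum_comm]
  have h2 : ∀ f : F → F, (∑ S : Finset F, (-1:ℂ)^(#Sᶜ) * (if univ.image f ⊆ S then ∏ c, g c (f c) else 0)) = if Function.Bijective f then ∏ c, g c (f c) else 0 := by
    intro f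
    have h3 : ∑ S : Finset F, (-1:ℂ)^(#Sᶜ) * (if univ.image f ⊆ S then ∏ c, g c (f c) else 0) = (∑ T ∈ (univ.image f)ᶜ.powerset, (-1:ℂ)^(#T)) * ∏ c, g c (f c) := by
      rw [sum_mul]
      simp_rw [mul_ite, mul_zero]
      rw [← sum_filter]
      refine sum_bij' (fun S _ => Sᶜ) (fun S _ => Sᶜ) ?_ ?_ ?_ ?_ ?_
      · intro S hS
        simpa using hS
      · intro S hS
        simp only [mem_powerset] at hS
        simp only [mem_filter, mem_univ, true_and]
        exact subset_compl_comm.1 hS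
      · simp
      · simp
      · simp
    rw [h3]
    have h4 := sum_powerset_neg_one_pow_card (x := (univ.image f)ᶜ)
    have h5 : (∑ T ∈ (univ.image f)ᶜ.powerset, (-1:ℂ)^(#T)) = if (univ.image f)ᶜ = ∅ then 1 else 0 := by
      exact_mod_cast congrArg (Int.cast : ℤ → ℂ) h4
    rw [h5]
    have h6 : (univ.image f)ᶜ = ∅ ↔ Function.Bijective f := by
      rw [compl_eq_empty_iff, ← Finite.surjective_iff_bijective]
      refine ⟨fun h y => ?_, fun h => image_univ_of_surjective h⟩
      have : y ∈ univ.image f := by rw [h]; exact mem_univ y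
      simpa using this
    simp [h6]
  rw [sum_congr rfl fun f _ => h2 f, ← sum_filter]
  refine sum_bij (fun σ _ => (σ : F → F)) ?_ ?_ ?_ ?_
  · intro σ _; simp
  · intro a _ b _ h; exact DFunLike.coe_injective h
  · intro f hf; exact ⟨Equiv.ofBijective f (by simpa using hf), by simp, rfl⟩
  · simp

lemma parseval {F : Type*} [Field F] [Fintype F] [DecidableEq F] (ψ : AddChar F ℂ) (hψ : ψ ≠ 1)
    (S : Finset F) : ∑ c : F, ‖∑ t ∈ S, ψ (c * t)‖ ^ 2 = Fintype.card F * #S := by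
  have hp := AddChar.IsPrimitive.of_ne_one hψ
  have h : ∀ c : F, ((‖∑ t ∈ S, ψ (c * t)‖ ^ 2 : ℝ) : ℂ) = ∑ t ∈ S, ∑ u ∈ S, ψ (c * (t - u)) := by
    intro c
    push_cast
    rw [← Complex.mul_conj', map_sum, sum_mul_sum]
    refine sum_congr rfl fun t _ => sum_congr rfl fun u _ => ?_
    rw [← AddChar.map_neg_eq_conj, ← AddChar.map_add_eq_mul]
    congr 1; ring
  have h2 : ((∑ c : F, ‖∑ t ∈ S, ψ (c * t)‖ ^ 2 : ℝ) : ℂ) = ((Fintype.card F * #S : ℝ) : ℂ) := by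
    rw [Complex.ofReal_sum, sum_congr rfl fun c _ => h c, sum_comm]
    have : ∀ t ∈ S, ∑ c : F, ∑ u ∈ S, ψ (c * (t - u)) = (Fintype.card F : ℂ) := by
      intro t ht
      rw [sum_comm]
      simp_rw [AddChar.sum_mulShift _ hp, sub_eq_zero]
      push_cast
      simp [ht]
    rw [sum_congr rfl this]
    simp [mul_comm]
  exact_mod_cast h2

lemma amgm {ι : Type*} (s : Finset ι) (hs : 0 < #s) (z : ι → ℝ) (hz : ∀ i ∈ s, 0 ≤ z i) :
    ∏ i ∈ s, z i ≤ ((∑ i ∈ s, z i) / #s) ^ #s := by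
  have h := Real.geom_mean_le_arith_mean s (fun _ => 1) z (by simp) (by simpa using hs) hz
  simp only [Real.rpow_one, sum_const, nsmul_eq_mul, mul_one, one_mul] at h
  have hp : 0 ≤ ∏ i ∈ s, z i := prod_nonneg hz
  calc ∏ i ∈ s, z i = ((∏ i ∈ s, z i) ^ ((#s : ℝ)⁻¹)) ^ #s := by
        rw [← Real.rpow_natCast, ← Real.rpow_mul hp, inv_mul_cancel₀ (by positivity), Real.rpow_one]
    _ ≤ _ := by gcongr

lemma prodbound {F : Type*} [Field F] [Fintype F] [DecidableEq F] (ψ : AddChar F ℂ) (hψ : ψ ≠ 1)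
    (hq : 2 < Fintype.card F) (S : Finset F) :
    ‖∏ c ∈ univ.erase (0:F), ∑ t ∈ S, ψ (c * t)‖ ≤
      Real.sqrt (((Fintype.card F : ℝ)^2 / (4 * (Fintype.card F - 1))) ^ (Fintype.card F - 1)) := by
  have hc : #(univ.erase (0:F)) = Fintype.card F - 1 := by rw [card_erase_of_mem (mem_univ _), card_univ]
  have hc' : ((Fintype.card F - 1 : ℕ) : ℝ) = (Fintype.card F : ℝ) - 1 := by
    rw [Nat.cast_sub (by omega)]; simp
  have hq' : (2:ℝ) < Fintype.card F := by exact_mod_cast hq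
  apply Real.le_sqrt_of_sq_le
  rw [norm_prod, ← prod_pow]
  refine (amgm _ (by omega) _ (fun _ _ => by positivity)).trans ?_
  have h := parseval ψ hψ S
  rw [← add_sum_erase _ _ (mem_univ (0:F))] at h
  simp only [zero_mul, AddChar.map_zero_eq_one, sum_const, nsmul_eq_mul, mul_one, Complex.norm_natCast] at h
  rw [hc, hc']
  refine pow_le_pow_left₀ (div_nonneg (sum_nonneg fun _ _ => by positivity) (by linarith)) ?_ _
  rw [eq_sub_of_add_eq' h, div_le_div_iff₀ (by linarith) (by linarith)]
  nlinarith [mul_nonneg (sub_nonneg.2 hq'.le) (sq_nonneg ((Fintype.card F : ℝ) - 2 * #S)), sq_nonneg ((Fintype.card F : ℝ) - 2 * #S)]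

lemma sum_abs_eq (F : Type*) [Fintype F] : ∑ S : Finset F, |2 * (#S : ℝ) - Fintype.card F| = DD (Fintype.card F) := by
  unfold DD
  have h1 := sum_powerset_apply_card (fun m : ℕ => |2 * (m : ℝ) - Fintype.card F|) (x := (univ : Finset F))
  have h2 := sum_powerset_apply_card (fun m : ℕ => |2 * (m : ℝ) - Fintype.card F|) (x := range (Fintype.card F))
  rw [card_range] at h2
  rw [powerset_univ, card_univ] at h1
  rw [h1, h2]

lemma permsum {F : Type*} [Field F] [Fintype F] [DecidableEq F] (ψ : AddChar F ℂ) (hψ : ψ ≠ 1)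
    (hq : 2 < Fintype.card F) :
    ‖∑ σ : Equiv.Perm F, ∏ c, ψ (c * σ c)‖ ≤ DD (Fintype.card F) / 2 *
      Real.sqrt (((Fintype.card F : ℝ)^2 / (4 * (Fintype.card F - 1))) ^ (Fintype.card F - 1)) := by
  rw [ryser (fun c t => ψ (c * t))]
  set R := Real.sqrt (((Fintype.card F : ℝ)^2 / (4 * (Fintype.card F - 1))) ^ (Fintype.card F - 1)) with hR
  set s : Finset F → ℂ := fun S => (-1)^(#Sᶜ) * ∏ c, ∑ t ∈ S, ψ (c * t) with hs
  set Q : Finset F → ℂ := fun S => ∏ c ∈ univ.erase (0:F), ∑ t ∈ S, ψ (c * t) with hQ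
  have hcard : #(univ.erase (0:F)) = Fintype.card F - 1 := by rw [card_erase_of_mem (mem_univ _), card_univ]
  have e1 : ∀ S, s S = (-1)^(#Sᶜ) * (#S * Q S) := by
    intro S
    simp only [hs, hQ]
    rw [← mul_prod_erase univ _ (mem_univ (0:F))]
    simp
  have e2 : ∀ S, Q Sᶜ = (-1)^(Fintype.card F - 1) * Q S := by
    intro S
    simp only [hQ]
    rw [← hcard, ← prod_const, ← prod_mul_distrib]
    refine prod_congr rfl fun c hc => ?_
    have hc0 : c ≠ 0 := (mem_erase.1 hc).1
    have := AddChar.sum_mulShift c (AddChar.IsPrimitive.of_ne_one hψ)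
    rw [if_neg hc0, ← sum_add_sum_compl S] at this
    simp_rw [mul_comm c]
    push_cast at this
    linear_combination this
  have e3 : ∀ S, s S + s Sᶜ = (-1)^(#Sᶜ) * ((2 * #S - Fintype.card F : ℝ) : ℂ) * Q S := by
    intro S
    have hadd := card_add_card_compl S
    have hsgn : (-1:ℂ)^(#S) * (-1)^(Fintype.card F - 1) = - (-1)^(#Sᶜ) := by
      have : (-1:ℂ)^(#S) * (-1)^(Fintype.card F - 1) * (-1) = (-1)^(#Sᶜ) := by
        rw [mul_assoc, ← pow_succ, ← pow_add, show #S + (Fintype.card F - 1 + 1) = 2 * #S + #Sᶜ by omega, pow_add, pow_mul]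
        simp
      linear_combination -this
    have hc : (#Sᶜ : ℂ) = Fintype.card F - #S := by rw [← hadd]; push_cast; ring
    rw [e1, e1, e2, compl_compl]
    rw [hc]
    push_cast
    linear_combination ((Fintype.card F : ℂ) - #S) * Q S * hsgn
  have e4 : 2 * ∑ S, s S = ∑ S, (s S + s Sᶜ) := by
    rw [sum_add_distrib, two_mul]
    congr 1
    exact (Equiv.sum_comp (compl_involutive.toPerm _ : Equiv.Perm (Finset F)) s).symm
  have e5 : ‖2 * ∑ S, s S‖ ≤ DD (Fintype.card F) * R := by
    rw [e4, ← sum_abs_eq, sum_mul]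
    refine norm_sum_le_of_le _ fun S _ => ?_
    rw [e3, norm_mul, norm_mul, norm_pow, norm_neg, norm_one, one_pow, one_mul, Complex.norm_real, Real.norm_eq_abs]
    exact mul_le_mul_of_nonneg_left (prodbound ψ hψ hq S) (abs_nonneg _)
  rw [norm_mul] at e5
  simp only [Complex.norm_ofNat] at e5
  linarith

lemma deg_iff {F : Type*} [Field F] [Fintype F] (hq : 2 < Fintype.card F) (σ : Equiv.Perm F) :
    (permPoly σ).degree < ((Fintype.card F - 2 : ℕ) : WithBot ℕ) ↔ ∑ c, c * σ c = 0 := by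
  have hco : ∀ m, Fintype.card F - 2 ≤ m → (permPoly σ).coeff m = - ∑ c, σ c * ((-c)^(Fintype.card F - 1 - m) * ((Fintype.card F - 1).choose m : F)) := by
    intro m hm
    rw [permPoly, finsetSum_coeff, ← sum_neg_distrib]
    refine sum_congr rfl fun c _ => ?_
    rw [coeff_C_mul, coeff_sub, coeff_one, if_neg (by omega), sub_eq_add_neg X (C c), ← C_neg, coeff_X_add_C_pow]
    ring
  have hkey : (permPoly σ).coeff (Fintype.card F - 2) = - ∑ c, c * σ c := by
    rw [hco _ le_rfl]
    congr 1
    refine sum_congr rfl fun c _ => ?_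
    have : (Fintype.card F - 1).choose (Fintype.card F - 2) = Fintype.card F - 1 := by
      rw [show Fintype.card F - 1 = Fintype.card F - 2 + 1 by omega, Nat.choose_succ_self_right]
    rw [this, show Fintype.card F - 1 - (Fintype.card F - 2) = 1 by omega, Nat.cast_sub (by omega), FiniteField.cast_card_eq_zero]
    push_cast; ring
  rw [degree_lt_iff_coeff_zero]
  constructor
  · intro h
    have := h _ le_rfl
    rw [hkey] at this
    exact neg_eq_zero.1 this
  · intro h m hm
    rcases hm.eq_or_lt with rfl | hm'
    · rw [hkey, h, neg_zero]
    · rw [hco m hm]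
      rcases (show Fintype.card F - 1 ≤ m by omega).eq_or_lt with rfl | h2
      · have h3 : ∑ c, σ c = ∑ c : F, c := Equiv.sum_comp σ (fun c => c)
        have h4 := FiniteField.sum_pow_lt_card_sub_one F 1 (by omega)
        simp only [pow_one] at h4
        simp [h3, h4]
      · simp [Nat.choose_eq_zero_of_lt h2]

lemma count {F : Type*} [Field F] [Fintype F] [DecidableEq F] (hq : 2 < Fintype.card F) :
    |(#{σ : Equiv.Perm F | ∑ c, c * σ c = 0} : ℝ) * Fintype.card F - (Fintype.card F).factorial| ≤
    (Fintype.card F - 1) * (DD (Fintype.card F) / 2 *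
      Real.sqrt (((Fintype.card F : ℝ)^2 / (4 * (Fintype.card F - 1))) ^ (Fintype.card F - 1))) := by
  set B := DD (Fintype.card F) / 2 *
      Real.sqrt (((Fintype.card F : ℝ)^2 / (4 * (Fintype.card F - 1))) ^ (Fintype.card F - 1))
  have h1 : (#{σ : Equiv.Perm F | ∑ c, c * σ c = 0} : ℂ) * Fintype.card F = ∑ ψ : AddChar F ℂ, ∑ σ : Equiv.Perm F, ∏ c, ψ (c * σ c) := by
    rw [sum_comm]
    have : ∀ σ : Equiv.Perm F, ∑ ψ : AddChar F ℂ, ∏ c, ψ (c * σ c) = if ∑ c, c * σ c = 0 then (Fintype.card F : ℂ) else 0 := by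
      intro σ
      rw [← AddChar.sum_apply_eq_ite]
      refine sum_congr rfl fun ψ _ => ?_
      have := map_prod ψ.toMonoidHom (fun c => Multiplicative.ofAdd (c * σ c)) univ
      rw [← ofAdd_sum] at this
      exact this.symm
    simp_rw [this]
    rw [← sum_filter, sum_const, nsmul_eq_mul]
  rw [← add_sum_erase _ _ (mem_univ (1 : AddChar F ℂ))] at h1
  have h0 : ∑ σ : Equiv.Perm F, ∏ c, (1 : AddChar F ℂ) (c * σ c) = ((Fintype.card F).factorial : ℂ) := by
    simp [Fintype.card_perm]
  rw [h0] at h1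
  have h2 : ‖∑ ψ ∈ univ.erase (1 : AddChar F ℂ), ∑ σ : Equiv.Perm F, ∏ c, ψ (c * σ c)‖ ≤ ((Fintype.card F : ℝ) - 1) * B := by
    refine (norm_sum_le_of_le _ (fun ψ hψ => permsum ψ (mem_erase.1 hψ).1 hq)).trans ?_
    rw [sum_const, card_erase_of_mem (mem_univ _), card_univ, AddChar.card_eq, nsmul_eq_mul, Nat.cast_sub (by omega), Nat.cast_one]
  rw [eq_sub_of_add_eq' h1.symm] at h2
  rw [← Real.norm_eq_abs, ← Complex.norm_real]
  push_cast
  exact h2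

theorem abs_N_sub_factorial_le (F : Type*) [Field F] [Fintype F]
    (q : ℕ) (hq : q = Fintype.card F) (hq2 : 2 < q)
    (N : ℕ)
    (hN : N = Nat.card {σ : Equiv.Perm F // (permPoly σ).degree < ((q - 2 : ℕ) : WithBot ℕ)}) :
    |(N : ℝ) - ((q - 1).factorial : ℝ)| ≤
      Real.sqrt (2 * Real.exp 1 / Real.pi) * (q : ℝ) ^ ((q : ℝ) / 2) := by
  classical
  have hN' : N = #{σ : Equiv.Perm F | ∑ c, c * σ c = 0} := by
    rw [hN, hq, Nat.card_eq_fintype_card, Fintype.card_subtype]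
    congr 1
    ext σ
    simp [deg_iff (hq ▸ hq2) σ]
  have h := count (F := F) (hq ▸ hq2)
  rw [← hN', ← hq] at h
  have hD := DD_sq q hq2
  have hD0 := DD_nonneg q
  have hq' : (2:ℝ) < q := by exact_mod_cast hq2
  have hfac : (q.factorial : ℝ) = (q-1).factorial * q := by
    rw [← Nat.mul_factorial_pred (show q ≠ 0 by omega)]; push_cast; ring
  rw [hfac, ← sub_mul, abs_mul, abs_of_pos (by linarith : (0:ℝ) < q)] at h
  obtain ⟨k, rfl⟩ : ∃ k, q = k + 2 := ⟨q - 2, by omega⟩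
  have hx : 0 ≤ |(N : ℝ) - ((k + 2 - 1).factorial : ℝ)| := abs_nonneg _
  set x := |(N : ℝ) - ((k + 2 - 1).factorial : ℝ)|
  clear_value x
  have hQ : ((k+2 : ℕ):ℝ) ^ (((k+2:ℕ) : ℝ)/2) = Real.sqrt (((k+2:ℕ):ℝ)^(k+2)) := by
    rw [Real.sqrt_eq_rpow, ← Real.rpow_natCast, ← Real.rpow_mul (by positivity)]
    congr 1; ring
  rw [hQ, ← Real.sqrt_mul (by positivity)]
  apply Real.le_sqrt_of_sq_le
  set D := DD (k+2)
  clear_value D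
  rw [show k + 2 - 1 = k + 1 by omega] at h
  set Q : ℝ := ((k+2 : ℕ) : ℝ) with hQdef
  have hk : (k:ℝ) = Q - 2 := by rw [hQdef]; push_cast; ring
  have hexp : Q ^ k ≤ Real.exp 1 * (Q-1)^k := by
    have h1 : Q / (Q-1) ≤ Real.exp (1/(Q-1)) := by
      have := Real.add_one_le_exp (1/(Q-1))
      have e : Q / (Q-1) = 1/(Q-1) + 1 := by field_simp [show Q - 1 ≠ 0 by linarith]; ring
      rw [e]; exact this
    have h2 : (Q / (Q-1))^k ≤ Real.exp 1 := by
      calc (Q / (Q-1))^k ≤ (Real.exp (1/(Q-1)))^k := by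
            gcongr
            exact div_nonneg (by linarith) (by linarith)
        _ = Real.exp (k * (1/(Q-1))) := by rw [Real.exp_nat_mul]
        _ ≤ Real.exp 1 := by
            apply Real.exp_le_exp.2
            rw [mul_one_div, div_le_one (by linarith), hk]; linarith
    rwa [div_pow, div_le_iff₀ (pow_pos (by linarith) _)] at h2
  have hQ1 : 0 < Q - 1 := by linarith
  clear_value Q
  set P := (Q^2 / (4 * (Q-1)))^(k+1) with hP
  have hP0 : 0 ≤ P := by positivity
  have hPe : P * (4^(k+1) * (Q-1)^(k+1)) = Q^(2*(k+1)) := by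
    rw [hP, ← mul_pow, ← mul_pow, pow_mul]
    congr 1; field_simp
  have h2 : (x * Q)^2 ≤ ((Q-1) * (D/2 * Real.sqrt P))^2 := by gcongr
  have h3 : ((Q-1) * (D/2 * Real.sqrt P))^2 = (Q-1)^2 * D^2 / 4 * P := by
    rw [mul_pow, mul_pow, Real.sq_sqrt hP0]; ring
  rw [h3] at h2
  have hpi := Real.pi_pos
  rw [div_mul_eq_mul_div, le_div_iff₀ hpi]
  have hK : 0 < Q^2 * (4^(k+1) * (Q-1)^(k+1)) := by positivity
  refine le_of_mul_le_mul_right ?_ hK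
  calc x^2 * Real.pi * (Q^2 * (4^(k+1) * (Q-1)^(k+1))) = (x*Q)^2 * (Real.pi * (4^(k+1) * (Q-1)^(k+1))) := by ring
    _ ≤ ((Q-1)^2 * D^2 / 4 * P) * (Real.pi * (4^(k+1) * (Q-1)^(k+1))) := by gcongr
    _ = (D^2 * (Real.pi * (Q-1))) * ((Q-1) / 4 * (P * (4^(k+1) * (Q-1)^(k+1)))) := by ring
    _ ≤ (2 * Q^2 * 4^(k+2)) * ((Q-1) / 4 * (P * (4^(k+1) * (Q-1)^(k+1)))) := by gcongr
    _ = (2 * Q^2 * 4^(k+2)) * ((Q-1) / 4 * Q^(2*(k+1))) := by rw [hPe]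
    _ = Q^k * (2 * 4^(k+1) * Q^(k+4) * (Q-1)) := by ring
    _ ≤ Real.exp 1 * (Q-1)^k * (2 * 4^(k+1) * Q^(k+4) * (Q-1)) := by gcongr
    _ = _ := by ring
end

section
/- Let q > 2 be a prime power and σ a permutation of 𝔽_q. Then the permutation polynomial f_σ has degree strictly smaller than q−2 if and only if ∑_{c ∈ 𝔽_q} c·σ(c) = 0. -/
open Finset Polynomial

theorem permPoly_coeff_aux {F : Type*} [Field F] [Fintype F] (σ : Equiv.Perm F) (k : ℕ)
    (hk : k ≠ 0) : (permPoly σ).coeff k =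
      -∑ c : F, σ c * ((-c) ^ (Fintype.card F - 1 - k) * ((Fintype.card F - 1).choose k : F)) := by
  unfold permPoly
  rw [Polynomial.finsetSum_coeff, ← Finset.sum_neg_distrib]
  refine Finset.sum_congr rfl fun c _ => ?_
  rw [Polynomial.coeff_C_mul, Polynomial.coeff_sub, sub_eq_add_neg Polynomial.X, ← Polynomial.C_neg,
    Polynomial.coeff_X_add_C_pow,
    Polynomial.coeff_one, if_neg hk]
  ring

theorem permPoly_degree_lt_iff (F : Type*) [Field F] [Fintype F]
    (hq2 : 2 < Fintype.card F) (σ : Equiv.Perm F) :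
    (permPoly σ).degree < ((Fintype.card F - 2 : ℕ) : WithBot ℕ) ↔
      ∑ c : F, c * σ c = 0 := by
  have hsum : ∑ c : F, σ c = 0 := by
    rw [Equiv.sum_comp σ (fun c => c)]
    simpa using FiniteField.sum_pow_lt_card_sub_one F 1 (by omega)
  have h2 : (permPoly σ).coeff (Fintype.card F - 2) = -∑ c : F, c * σ c := by
    rw [permPoly_coeff_aux σ _ (by omega)]
    obtain ⟨m, hm⟩ : ∃ m, Fintype.card F = m + 2 := ⟨Fintype.card F - 2, by omega⟩
    have hc : ((m : F) + 2) = 0 := by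
      have := FiniteField.cast_card_eq_zero F
      rw [hm] at this
      exact_mod_cast this
    have e1 : Fintype.card F - 1 = m + 1 := by omega
    have e2 : Fintype.card F - 2 = m := by omega
    rw [e1, e2]
    congr 1
    refine Finset.sum_congr rfl fun c _ => ?_
    have e3 : m + 1 - m = 1 := by omega
    rw [e3, Nat.choose_succ_self_right, pow_one]
    push_cast
    linear_combination (-(σ c * c)) * hc
  rw [Polynomial.degree_lt_iff_coeff_zero]
  constructor
  · intro h
    have := h _ le_rfl
    rw [h2] at this
    exact neg_eq_zero.mp this
  · intro h k hk
    rcases hk.eq_or_lt with rfl | hlt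
    · rw [h2, h, neg_zero]
    · rw [permPoly_coeff_aux σ _ (by omega)]
      rcases (show Fintype.card F - 1 ≤ k by omega).eq_or_lt with rfl | hlt'
      · simp [hsum]
      · simp [Nat.choose_eq_zero_of_lt hlt']
end
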